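/- Fix p > 1. Let X₁,…,X_N and Y₁,…,Y_N be 2N independent uniform random variables on [0,1] with order statistics X₍₁₎ ≤ … ≤ X₍N₎ and Y₍₁₎ ≤ … ≤ Y₍N₎. Then lim_{N→∞} N^{p/2} · E[ (1/N) Σᵢ |X₍ᵢ₎ − Y₍ᵢ₎|^p ] = Γ(1 + p/2)/(p+1). Equivalently, the average optimal cost per edge of the random Euclidean assignment problem on [0,1] with cost z^p satisfies N^{p/2}·ε_N^{(p)} → Γ(1+p/2)/(p+1) as N → ∞. -/

import Mathlib

open MeasureTheory

/-- The uniform probability measure on `[0,1]`. -/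
noncomputable def unif : Measure ℝ := volume.restrict (Set.Icc 0 1)

/-- The law of `N` independent uniform points on `[0,1]`. -/
noncomputable def unifPi (N : ℕ) : Measure (Fin N → ℝ) :=
  Measure.pi fun _ => unif

/-- The increasing rearrangement (order statistics) of a tuple. -/
noncomputable def sortedTuple {N : ℕ} (ω : Fin N → ℝ) (i : Fin N) : ℝ :=
  ω (Tuple.sort ω i)

section

open Set Filter Topology


instance isProbabilityMeasure_unif : IsProbabilityMeasure unif :=
  ⟨by simp [unif]⟩

instance isProbabilityMeasure_unifPi (N : ℕ) : IsProbabilityMeasure (unifPi N) := by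
  unfold unifPi; infer_instance

lemma unif_Iic (t : ℝ) : unif (Iic t) = ENNReal.ofReal (max 0 (min t 1)) := by
  rw [unif, Measure.restrict_apply measurableSet_Iic]
  have h : Iic t ∩ Icc 0 1 = Icc 0 (min t 1) := by
    ext x
    simp only [mem_inter_iff, mem_Iic, mem_Icc, le_min_iff]
    tauto
  rw [h, Real.volume_Icc, sub_zero, max_comm, ENNReal.ofReal_max]
  simp

lemma unif_Ioi (t : ℝ) : unif (Ioi t) = ENNReal.ofReal (1 - max 0 (min t 1)) := by
  rw [← compl_Iic, prob_compl_eq_one_sub measurableSet_Iic, unif_Iic,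
    ENNReal.ofReal_sub _ (le_max_left _ _), ENNReal.ofReal_one]

lemma sortedTuple_le_iff {N : ℕ} (ω : Fin N → ℝ) (k : Fin N) (t : ℝ) :
    sortedTuple ω k ≤ t ↔ (k : ℕ) < (Finset.univ.filter fun i => ω i ≤ t).card := by
  have h := Tuple.lt_card_le_iff_apply_le_of_monotone (a := t) (j := k) (Tuple.monotone_sort ω)
  have hc : (Finset.univ.filter fun i => (ω ∘ Tuple.sort ω) i ≤ t).card =
      (Finset.univ.filter fun i => ω i ≤ t).card :=
    Finset.card_equiv (Tuple.sort ω) (by simp)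
  rw [← hc, h]
  rfl

lemma filter_le_eq_preimage {N : ℕ} (S : Finset (Fin N)) (t : ℝ) :
    {ω : Fin N → ℝ | (Finset.univ.filter fun i => ω i ≤ t) = S} =
      Set.pi univ fun i => if i ∈ S then Iic t else Ioi t := by
  ext ω
  simp only [mem_ofPred_eq, Finset.ext_iff, Finset.mem_filter, Finset.mem_univ, true_and, Set.mem_pi,
    Set.mem_univ, true_implies]
  refine forall_congr' fun i => ?_
  by_cases hi : i ∈ S <;> simp [hi]

lemma measurableSet_filter_le_eq {N : ℕ} (S : Finset (Fin N)) (t : ℝ) :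
    MeasurableSet {ω : Fin N → ℝ | (Finset.univ.filter fun i => ω i ≤ t) = S} := by
  rw [filter_le_eq_preimage]
  refine MeasurableSet.univ_pi fun i => ?_
  split_ifs
  exacts [measurableSet_Iic, measurableSet_Ioi]

lemma setOf_sortedTuple_le_eq_biUnion {N : ℕ} (k : Fin N) (t : ℝ) :
    {ω : Fin N → ℝ | sortedTuple ω k ≤ t} =
      ⋃ S ∈ Finset.univ.filter (fun S : Finset (Fin N) => (k : ℕ) < S.card),
        {ω : Fin N → ℝ | (Finset.univ.filter fun i => ω i ≤ t) = S} := by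
  ext ω
  simp [sortedTuple_le_iff]

lemma measurable_sortedTuple {N : ℕ} (k : Fin N) :
    Measurable fun ω : Fin N → ℝ => sortedTuple ω k := by
  refine measurable_of_Iic fun t => ?_
  change MeasurableSet {ω : Fin N → ℝ | sortedTuple ω k ≤ t}
  rw [setOf_sortedTuple_le_eq_biUnion]
  exact Finset.measurableSet_biUnion _ fun S _ => measurableSet_filter_le_eq S t

lemma unifPi_filter_le_eq {N : ℕ} (S : Finset (Fin N)) (t : ℝ) :
    unifPi N {ω | (Finset.univ.filter fun i => ω i ≤ t) = S} =
      ENNReal.ofReal (max 0 (min t 1) ^ S.card * (1 - max 0 (min t 1)) ^ (N - S.card)) := by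
  have h1 : 0 ≤ max 0 (min t 1) := le_max_left _ _
  have h2 : 0 ≤ 1 - max 0 (min t 1) := by simp
  rw [filter_le_eq_preimage, unifPi, Measure.pi_pi]
  have : ∀ i, unif (if i ∈ S then Iic t else Ioi t) =
      if i ∈ S then ENNReal.ofReal (max 0 (min t 1)) else
        ENNReal.ofReal (1 - max 0 (min t 1)) := by
    intro i
    split_ifs
    exacts [unif_Iic t, unif_Ioi t]
  simp_rw [this]
  rw [Finset.prod_ite, Finset.prod_const, Finset.prod_const, ENNReal.ofReal_mul (by positivity),
    ENNReal.ofReal_pow h1, ENNReal.ofReal_pow h2]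
  congr 3
  · simp
  · rw [← Finset.compl_filter, Finset.card_compl]
    simp

/-- The distribution function of the `k`-th order statistic. -/
lemma unifPi_sortedTuple_le {N : ℕ} (k : Fin N) (t : ℝ) :
    unifPi N {ω | sortedTuple ω k ≤ t} =
      ENNReal.ofReal (∑ j ∈ Finset.Ico (k : ℕ) N,
        (bernsteinPolynomial ℝ N (j + 1)).eval (max 0 (min t 1))) := by
  have h1 : 0 ≤ max 0 (min t 1) := le_max_left _ _
  have h2 : 0 ≤ 1 - max 0 (min t 1) := by simp
  rw [setOf_sortedTuple_le_eq_biUnion, measure_biUnion_finset]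
  · simp_rw [unifPi_filter_le_eq]
    generalize max 0 (min t 1) = c at *
    rw [← ENNReal.ofReal_sum_of_nonneg (fun _ _ => by positivity), Finset.sum_filter]
    congr 1
    have := Finset.sum_powerset_apply_card
      (fun m => if (k : ℕ) < m then c ^ m * (1 - c) ^ (N - m) else 0)
      (x := (Finset.univ : Finset (Fin N)))
    rw [Finset.powerset_univ] at this
    rw [this, Finset.card_univ, Fintype.card_fin,
      Finset.sum_Ico_add' (fun j => (bernsteinPolynomial ℝ N j).eval c) _ _ 1]
    simp_rw [smul_ite, smul_zero]
    rw [← Finset.sum_filter]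
    refine Finset.sum_congr ?_ fun m _ => ?_
    · ext m
      simp only [Finset.mem_filter, Finset.mem_range, Finset.mem_Ico]
      omega
    · simp [bernsteinPolynomial, mul_assoc]
  · intro S _ T _ hST
    refine Set.disjoint_left.2 fun ω h h' => hST ?_
    rw [← h, ← h']
  · exact fun S _ => measurableSet_filter_le_eq S t

/-- The density of the `k`-th order statistic. -/
noncomputable def orderDensity (N k : ℕ) (x : ℝ) : ℝ :=
  N * (bernsteinPolynomial ℝ (N - 1) k).eval x

lemma hasDerivAt_sum_bernstein {N : ℕ} {k : ℕ} (hk : k ≤ N) (x : ℝ) :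
    HasDerivAt (fun x => ∑ j ∈ Finset.Ico k N, (bernsteinPolynomial ℝ N (j + 1)).eval x)
      (orderDensity N k x) x := by
  unfold orderDensity
  have h := HasDerivAt.fun_sum (u := Finset.Ico k N) fun j _ =>
    (bernsteinPolynomial ℝ N (j + 1)).hasDerivAt x
  refine h.congr_deriv ?_
  simp_rw [bernsteinPolynomial.derivative_succ, Polynomial.eval_mul, Polynomial.eval_sub,
    Polynomial.eval_natCast, ← Finset.mul_sum]
  have h2 : ∑ j ∈ Finset.Ico k N, ((bernsteinPolynomial ℝ (N - 1) j).eval x -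
      (bernsteinPolynomial ℝ (N - 1) (j + 1)).eval x) =
      (bernsteinPolynomial ℝ (N - 1) k).eval x - (bernsteinPolynomial ℝ (N - 1) N).eval x := by
    rw [← neg_sub, ← Finset.sum_Ico_sub (fun j => (bernsteinPolynomial ℝ (N - 1) j).eval x) hk,
      ← Finset.sum_neg_distrib]
    simp
  rw [h2]
  rcases Nat.eq_zero_or_pos N with rfl | hN
  · simp
  · rw [bernsteinPolynomial.eq_zero_of_lt ℝ (show N - 1 < N by omega)]
    simp

lemma orderDensity_eq (N k : ℕ) (x : ℝ) :
    orderDensity N k x = N * ((N - 1).choose k * x ^ k * (1 - x) ^ (N - 1 - k)) := by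
  simp [orderDensity, bernsteinPolynomial]

lemma continuous_orderDensity (N k : ℕ) : Continuous (orderDensity N k) := by
  unfold orderDensity
  fun_prop

lemma orderDensity_nonneg (N k : ℕ) {x : ℝ} (hx : x ∈ Icc (0 : ℝ) 1) :
    0 ≤ orderDensity N k x := by
  have := hx.1
  have : 0 ≤ 1 - x := sub_nonneg.2 hx.2
  rw [orderDensity_eq]
  positivity

lemma map_sortedTuple {N : ℕ} (k : Fin N) :
    (unifPi N).map (fun ω => sortedTuple ω k) =
      unif.withDensity fun x => ENNReal.ofReal (orderDensity N k x) := by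
  have : IsProbabilityMeasure ((unifPi N).map (fun ω => sortedTuple ω k)) :=
    Measure.isProbabilityMeasure_map (measurable_sortedTuple k).aemeasurable
  refine Measure.ext_of_Iic _ _ fun t => ?_
  rw [Measure.map_apply (measurable_sortedTuple k) measurableSet_Iic]
  change unifPi N {ω | sortedTuple ω k ≤ t} = _
  rw [unifPi_sortedTuple_le, withDensity_apply _ measurableSet_Iic, unif,
    Measure.restrict_restrict measurableSet_Iic]
  have h : Iic t ∩ Icc 0 1 = Icc 0 (min t 1) := by
    ext x
    simp only [mem_inter_iff, mem_Iic, mem_Icc, le_min_iff]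
    tauto
  rw [h]
  have hz : ∑ j ∈ Finset.Ico (k : ℕ) N, (bernsteinPolynomial ℝ N (j + 1)).eval 0 = 0 :=
    Finset.sum_eq_zero fun j _ => by simp [bernsteinPolynomial.eval_at_0]
  rcases le_or_gt 0 (min t 1) with h0 | h0
  · rw [max_eq_right h0, ← ofReal_integral_eq_lintegral_ofReal, integral_Icc_eq_integral_Ioc,
      ← intervalIntegral.integral_of_le h0,
      intervalIntegral.integral_eq_sub_of_hasDerivAt
        (fun x _ => hasDerivAt_sum_bernstein k.2.le x)
        ((continuous_orderDensity N k).intervalIntegrable _ _), hz, sub_zero]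
    · exact (continuous_orderDensity N k).continuousOn.integrableOn_Icc
    · filter_upwards [ae_restrict_mem measurableSet_Icc] with x hx
      exact orderDensity_nonneg N k ⟨hx.1, hx.2.trans (min_le_right _ _)⟩
  · rw [max_eq_left h0.le, Icc_eq_empty (not_le.2 h0), hz]
    simp

/-- The joint law of the `k`-th order statistics of the two samples. -/
lemma map_prod_sortedTuple {N : ℕ} (k : Fin N) :
    ((unifPi N).prod (unifPi N)).map
        (fun ω => (sortedTuple ω.1 k, sortedTuple ω.2 k)) =
      (unif.prod unif).withDensity fun z =>
        ENNReal.ofReal (orderDensity N k z.1) * ENNReal.ofReal (orderDensity N k z.2) := by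
  have hm := measurable_sortedTuple k
  have hd : Measurable fun x => ENNReal.ofReal (orderDensity N k x) :=
    (continuous_orderDensity N k).measurable.ennreal_ofReal
  have h := Measure.map_prod_map (unifPi N) (unifPi N) hm hm
  rw [map_sortedTuple k, prod_withDensity hd hd] at h
  exact h.symm

lemma measurable_prodMk_sortedTuple {N : ℕ} (k : Fin N) :
    Measurable fun ω : (Fin N → ℝ) × (Fin N → ℝ) => (sortedTuple ω.1 k, sortedTuple ω.2 k) :=
  ((measurable_sortedTuple k).comp measurable_fst).prodMk
    ((measurable_sortedTuple k).comp measurable_snd)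

lemma ae_mem_prod_unif : ∀ᵐ z ∂(unif.prod unif), z ∈ Icc (0 : ℝ) 1 ×ˢ Icc (0 : ℝ) 1 := by
  rw [unif, Measure.prod_restrict]
  exact ae_restrict_mem (measurableSet_Icc.prod measurableSet_Icc)

lemma integrable_sortedTuple {N : ℕ} (k : Fin N) {f : ℝ × ℝ → ℝ} (hf : Continuous f) :
    Integrable (fun ω : (Fin N → ℝ) × (Fin N → ℝ) => f (sortedTuple ω.1 k, sortedTuple ω.2 k))
      ((unifPi N).prod (unifPi N)) := by
  have hm := measurable_prodMk_sortedTuple k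
  obtain ⟨C, hC⟩ := ((isCompact_Icc (a := (0 : ℝ)) (b := 1)).prod
    (isCompact_Icc (a := (0 : ℝ)) (b := 1))).exists_bound_of_continuousOn hf.continuousOn
  refine Integrable.of_bound (hf.measurable.comp hm).aestronglyMeasurable C ?_
  have h : ∀ᵐ z ∂(((unifPi N).prod (unifPi N)).map
      (fun ω => (sortedTuple ω.1 k, sortedTuple ω.2 k))), ‖f z‖ ≤ C := by
    rw [map_prod_sortedTuple]
    refine (withDensity_absolutelyContinuous _ _).ae_le ?_
    filter_upwards [ae_mem_prod_unif] with z hz using hC z hz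
  exact ae_of_ae_map hm.aemeasurable h

lemma integral_sortedTuple {N : ℕ} (k : Fin N) {f : ℝ × ℝ → ℝ} (hf : Measurable f) :
    ∫ ω : (Fin N → ℝ) × (Fin N → ℝ), f (sortedTuple ω.1 k, sortedTuple ω.2 k)
        ∂((unifPi N).prod (unifPi N)) =
      ∫ z, orderDensity N k z.1 * orderDensity N k z.2 * f z ∂(unif.prod unif) := by
  have hd : Measurable fun x => ENNReal.ofReal (orderDensity N k x) :=
    (continuous_orderDensity N k).measurable.ennreal_ofReal
  rw [← integral_map (measurable_prodMk_sortedTuple k).aemeasurable hf.aestronglyMeasurable,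
    map_prod_sortedTuple, integral_withDensity_eq_integral_toReal_smul
      (show Measurable fun z : ℝ × ℝ => ENNReal.ofReal (orderDensity N k z.1) *
          ENNReal.ofReal (orderDensity N k z.2) from
        (hd.comp measurable_fst).mul (hd.comp measurable_snd))
      (Eventually.of_forall fun _ => ENNReal.mul_lt_top ENNReal.ofReal_lt_top ENNReal.ofReal_lt_top)]
  refine integral_congr_ae ?_
  filter_upwards [ae_mem_prod_unif] with z hz
  rw [ENNReal.toReal_mul, ENNReal.toReal_ofReal (orderDensity_nonneg N k hz.1),
    ENNReal.toReal_ofReal (orderDensity_nonneg N k hz.2), smul_eq_mul]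

/-- The homogeneous polynomial `∑ k, (n.choose k)² u ^ k v ^ (n - k)`. -/
noncomputable def sqChooseSum (n : ℕ) (u v : ℝ) : ℝ :=
  ∑ k ∈ Finset.range (n + 1), (n.choose k : ℝ) ^ 2 * (u ^ k * v ^ (n - k))

/-- The derivative of `sqChooseSum` in its first variable. -/
noncomputable def sqChooseSumFst (n : ℕ) (u v : ℝ) : ℝ :=
  ∑ k ∈ Finset.range (n + 1), (n.choose k : ℝ) ^ 2 * ((k * u ^ (k - 1)) * v ^ (n - k))

/-- The derivative of `sqChooseSum` in its second variable. -/
noncomputable def sqChooseSumSnd (n : ℕ) (u v : ℝ) : ℝ :=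
  ∑ k ∈ Finset.range (n + 1),
    (n.choose k : ℝ) ^ 2 * (u ^ k * ((n - k : ℕ) * v ^ (n - k - 1)))

@[fun_prop]
lemma continuous_sqChooseSum {X : Type*} [TopologicalSpace X] (n : ℕ) {u v : X → ℝ}
    (hu : Continuous u) (hv : Continuous v) : Continuous fun x => sqChooseSum n (u x) (v x) := by
  unfold sqChooseSum
  fun_prop

@[fun_prop]
lemma continuous_sqChooseSumFst {X : Type*} [TopologicalSpace X] (n : ℕ) {u v : X → ℝ}
    (hu : Continuous u) (hv : Continuous v) :
    Continuous fun x => sqChooseSumFst n (u x) (v x) := by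
  unfold sqChooseSumFst
  fun_prop

@[fun_prop]
lemma continuous_sqChooseSumSnd {X : Type*} [TopologicalSpace X] (n : ℕ) {u v : X → ℝ}
    (hu : Continuous u) (hv : Continuous v) :
    Continuous fun x => sqChooseSumSnd n (u x) (v x) := by
  unfold sqChooseSumSnd
  fun_prop

lemma hasDerivAt_sqChooseSum (n : ℕ) {u v : ℝ → ℝ} {u' v' x : ℝ} (hu : HasDerivAt u u' x)
    (hv : HasDerivAt v v' x) :
    HasDerivAt (fun x => sqChooseSum n (u x) (v x))
      (sqChooseSumFst n (u x) (v x) * u' + sqChooseSumSnd n (u x) (v x) * v') x := by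
  have h := HasDerivAt.fun_sum (u := Finset.range (n + 1)) fun k _ =>
    ((hu.pow k).mul (hv.pow (n - k))).const_mul ((n.choose k : ℝ) ^ 2)
  refine h.congr_deriv ?_
  rw [sqChooseSumFst, sqChooseSumSnd, Finset.sum_mul, Finset.sum_mul, ← Finset.sum_add_distrib]
  refine Finset.sum_congr rfl fun k _ => ?_
  simp only [Pi.pow_apply]
  ring

lemma choose_sq_identity {n k : ℕ} (hk : k ≤ n) :
    ((n + 1).choose (k + 1) : ℝ) ^ 2 * (k + 1) +
        ((n + 1).choose k : ℝ) ^ 2 * ((n - k : ℕ) + 1) =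
      2 * (n.choose k : ℝ) ^ 2 + 3 * ((n.choose k : ℝ) ^ 2 * k) +
        3 * ((n.choose k : ℝ) ^ 2 * (n - k : ℕ)) +
        (n.choose (k + 1) : ℝ) ^ 2 * (k + 1) + k * n.choose k * n.choose (k - 1) := by
  have h1 : (n.choose (k + 1) : ℝ) * (k + 1) = n.choose k * (n - k : ℕ) := by
    exact_mod_cast Nat.choose_succ_right_eq n k
  rw [Nat.choose_succ_succ n k]
  rcases k with _ | k
  · simp only [Nat.choose_zero_right, CharP.cast_eq_zero, Nat.sub_zero] at h1 ⊢
    push_cast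
    linear_combination 2 * h1
  · have h2 : (n.choose (k + 1) : ℝ) * (k + 1) = n.choose k * ((n - (k + 1) : ℕ) + 1) := by
      have := Nat.choose_succ_right_eq n k
      rw [show n - k = n - (k + 1) + 1 by omega] at this
      exact_mod_cast this
    rw [Nat.choose_succ_succ n k]
    push_cast at h1 ⊢
    linear_combination 2 * (n.choose (k + 1) : ℝ) * h1 -
      (2 * (n.choose (k + 1) : ℝ) + n.choose k) * h2

lemma sqChooseSumFst_add_sqChooseSumSnd_succ (n : ℕ) (u v : ℝ) :
    sqChooseSumFst (n + 1) u v + sqChooseSumSnd (n + 1) u v =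
      2 * sqChooseSum n u v + (3 * u + v) * sqChooseSumFst n u v +
        (u + 3 * v) * sqChooseSumSnd n u v := by
  have h1 : sqChooseSumFst (n + 1) u v = ∑ k ∈ Finset.range (n + 1),
      ((n + 1).choose (k + 1) : ℝ) ^ 2 * (k + 1) * (u ^ k * v ^ (n - k)) := by
    rw [sqChooseSumFst, Finset.sum_range_succ']
    simp [mul_assoc]
  have h2 : sqChooseSumSnd (n + 1) u v = ∑ k ∈ Finset.range (n + 1),
      ((n + 1).choose k : ℝ) ^ 2 * ((n - k : ℕ) + 1) * (u ^ k * v ^ (n - k)) := by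
    rw [sqChooseSumSnd, Finset.sum_range_succ]
    simp only [Nat.sub_self, CharP.cast_eq_zero, zero_mul, mul_zero, add_zero]
    refine Finset.sum_congr rfl fun k hk => ?_
    rw [show n + 1 - k = n - k + 1 by have := Finset.mem_range.1 hk; omega]
    push_cast
    ring
  have h3 : u * sqChooseSumFst n u v = ∑ k ∈ Finset.range (n + 1),
      (n.choose k : ℝ) ^ 2 * k * (u ^ k * v ^ (n - k)) := by
    rw [sqChooseSumFst, Finset.mul_sum]
    refine Finset.sum_congr rfl fun k _ => ?_
    rcases k with _ | k
    · simp
    · rw [Nat.add_sub_cancel, pow_succ]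
      ring
  have h4 : v * sqChooseSumSnd n u v = ∑ k ∈ Finset.range (n + 1),
      (n.choose k : ℝ) ^ 2 * (n - k : ℕ) * (u ^ k * v ^ (n - k)) := by
    rw [sqChooseSumSnd, Finset.mul_sum]
    refine Finset.sum_congr rfl fun k _ => ?_
    rcases n - k with _ | j
    · simp
    · rw [Nat.add_sub_cancel, pow_succ]
      ring
  have h5 : v * sqChooseSumFst n u v = ∑ k ∈ Finset.range (n + 1),
      (n.choose (k + 1) : ℝ) ^ 2 * (k + 1) * (u ^ k * v ^ (n - k)) := by
    rw [sqChooseSumFst, Finset.sum_range_succ', Finset.sum_range_succ _ n, mul_add, Finset.mul_sum]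
    simp only [CharP.cast_eq_zero, zero_mul, mul_zero, Nat.choose_succ_self, ne_eq,
      OfNat.ofNat_ne_zero, not_false_eq_true, zero_pow]
    congr 1
    refine Finset.sum_congr rfl fun k hk => ?_
    rw [show n - k = n - (k + 1) + 1 by have := Finset.mem_range.1 hk; omega, pow_succ,
      Nat.add_sub_cancel]
    push_cast
    ring
  have h6 : u * sqChooseSumSnd n u v = ∑ k ∈ Finset.range (n + 1),
      k * n.choose k * n.choose (k - 1) * (u ^ k * v ^ (n - k)) := by
    rw [sqChooseSumSnd, Finset.sum_range_succ, Finset.sum_range_succ' _ n, mul_add, Finset.mul_sum]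
    simp only [CharP.cast_eq_zero, zero_mul, mul_zero, Nat.sub_self]
    congr 1
    refine Finset.sum_congr rfl fun k hk => ?_
    have := Nat.choose_succ_right_eq n k
    have h : (n.choose (k + 1) : ℝ) * (k + 1) = n.choose k * (n - k : ℕ) := by
      exact_mod_cast this
    rw [Nat.add_sub_cancel, Nat.sub_sub]
    push_cast
    linear_combination -(n.choose k : ℝ) * u ^ (k + 1) * v ^ (n - (k + 1)) * h
  have h7 : sqChooseSum n u v = ∑ k ∈ Finset.range (n + 1),
      (n.choose k : ℝ) ^ 2 * (u ^ k * v ^ (n - k)) := rfl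
  have h8 : (3 * u + v) * sqChooseSumFst n u v + (u + 3 * v) * sqChooseSumSnd n u v =
      3 * (u * sqChooseSumFst n u v) + 3 * (v * sqChooseSumSnd n u v) +
        v * sqChooseSumFst n u v + u * sqChooseSumSnd n u v := by ring
  rw [add_assoc (2 * _), h8, h1, h2, h3, h4, h5, h6, h7]
  simp only [Finset.mul_sum, ← Finset.sum_add_distrib]
  refine Finset.sum_congr rfl fun k hk => ?_
  linear_combination (u ^ k * v ^ (n - k)) *
    choose_sq_identity (Nat.lt_succ_iff.1 (Finset.mem_range.1 hk))

/-- The product `x y` at `x = (1 - d) s`, `y = x + d`. -/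
def lowerProd (s d : ℝ) : ℝ := (1 - d) * s * ((1 - d) * s + d)

/-- The product `(1 - x) (1 - y)` at `x = (1 - d) s`, `y = x + d`. -/
def upperProd (s d : ℝ) : ℝ := (1 - d) * (1 - s) * (1 - (1 - d) * s)

@[fun_prop]
lemma continuous_lowerProd {X : Type*} [TopologicalSpace X] {s d : X → ℝ}
    (hs : Continuous s) (hd : Continuous d) : Continuous fun x => lowerProd (s x) (d x) := by
  unfold lowerProd
  fun_prop

@[fun_prop]
lemma continuous_upperProd {X : Type*} [TopologicalSpace X] {s d : X → ℝ}
    (hs : Continuous s) (hd : Continuous d) : Continuous fun x => upperProd (s x) (d x) := by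
  unfold upperProd
  fun_prop

lemma hasDerivAt_lowerProd_left (s d : ℝ) :
    HasDerivAt (fun s => lowerProd s d) ((1 - d) * (2 * (1 - d) * s + d)) s := by
  have h := (((hasDerivAt_id s).const_mul (1 - d)).mul
    (((hasDerivAt_id s).const_mul (1 - d)).add_const d))
  refine h.congr_deriv ?_
  simp only [id]
  ring

lemma hasDerivAt_upperProd_left (s d : ℝ) :
    HasDerivAt (fun s => upperProd s d)
      (-(1 - d) * (1 - (1 - d) * s) - (1 - d) ^ 2 * (1 - s)) s := by
  have h := ((((hasDerivAt_id s).const_sub 1).const_mul (1 - d)).mul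
    (((hasDerivAt_id s).const_mul (1 - d)).const_sub 1))
  refine h.congr_deriv ?_
  simp only [id]
  ring

lemma hasDerivAt_lowerProd_right (s d : ℝ) :
    HasDerivAt (fun d => lowerProd s d) (-s * ((1 - d) * s + d) + (1 - d) * s * (1 - s)) d := by
  have h := (((hasDerivAt_id d).const_sub 1).mul_const s).mul
    ((((hasDerivAt_id d).const_sub 1).mul_const s).add (hasDerivAt_id d))
  refine h.congr_deriv ?_
  simp only [id, Pi.add_apply]
  ring

lemma hasDerivAt_upperProd_right (s d : ℝ) :
    HasDerivAt (fun d => upperProd s d)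
      (-(1 - s) * (1 - (1 - d) * s) + (1 - d) * (1 - s) * s) d := by
  have h := (((hasDerivAt_id d).const_sub 1).mul_const (1 - s)).mul
    ((((hasDerivAt_id d).const_sub 1).mul_const s).const_sub 1)
  refine h.congr_deriv ?_
  simp only [id]
  ring

/-- An antiderivative, along the translations `(x, y) ↦ (x + t, y + t)`, of the derivative of
`sqChooseSum n (x y) ((1 - x) (1 - y))` in `y - x`, at `x = (1 - d) s`, `y = x + d`. -/
noncomputable def gapFlux : ℕ → ℝ → ℝ → ℝ
  | 0, _, _ => 0
  | n + 1, s, d => (1 - d ^ 2) * gapFlux n s d -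
      d * ((1 - d) * (s - 1 / 2)) * sqChooseSum n (lowerProd s d) (upperProd s d)

lemma hasDerivAt_gapFlux (n : ℕ) (s d : ℝ) :
    HasDerivAt (fun s => gapFlux n s d)
      ((1 - d) * (-(d / 2) * (sqChooseSumFst n (lowerProd s d) (upperProd s d) +
        sqChooseSumSnd n (lowerProd s d) (upperProd s d)))) s := by
  induction n with
  | zero => simpa [gapFlux, sqChooseSumFst, sqChooseSumSnd] using hasDerivAt_const s (0 : ℝ)
  | succ n ih =>
    have h := (ih.const_mul (1 - d ^ 2)).sub
      (((((hasDerivAt_id s).sub_const (1 / 2)).const_mul (1 - d)).const_mul d).mul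
        (hasDerivAt_sqChooseSum n (hasDerivAt_lowerProd_left s d) (hasDerivAt_upperProd_left s d)))
    refine h.congr_deriv ?_
    rw [sqChooseSumFst_add_sqChooseSumSnd_succ]
    generalize sqChooseSumFst n (lowerProd s d) (upperProd s d) = a
    generalize sqChooseSumSnd n (lowerProd s d) (upperProd s d) = b
    generalize sqChooseSum n (lowerProd s d) (upperProd s d) = c
    simp only [lowerProd, upperProd, id]
    ring

lemma sqChooseSum_comm (n : ℕ) (u v : ℝ) : sqChooseSum n u v = sqChooseSum n v u := by
  rw [sqChooseSum, ← Finset.sum_range_reflect, sqChooseSum]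
  refine Finset.sum_congr rfl fun k hk => ?_
  have hk : k ≤ n := Nat.lt_succ_iff.1 (Finset.mem_range.1 hk)
  rw [Nat.add_sub_cancel, Nat.choose_symm hk, Nat.sub_sub_self hk, mul_comm (u ^ _)]

lemma sqChooseSum_zero_right (n : ℕ) (u : ℝ) : sqChooseSum n u 0 = u ^ n := by
  rw [sqChooseSum, Finset.sum_range_succ, Finset.sum_eq_zero]
  · simp
  · intro k hk
    rw [zero_pow (Nat.sub_ne_zero_of_lt (Finset.mem_range.1 hk))]
    simp

lemma sqChooseSum_zero_left (n : ℕ) (v : ℝ) : sqChooseSum n 0 v = v ^ n := by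
  rw [sqChooseSum, Finset.sum_range_succ']
  simp

lemma gapFlux_one (n : ℕ) (d : ℝ) :
    gapFlux n 1 d = -(1 / 2) * ((1 - d ^ 2) ^ n - (1 - d) ^ n) := by
  induction n with
  | zero => simp [gapFlux]
  | succ n ih =>
    rw [gapFlux, ih, show upperProd 1 d = 0 by simp [upperProd],
      show lowerProd 1 d = 1 - d by simp [lowerProd], sqChooseSum_zero_right]
    ring

lemma gapFlux_zero (n : ℕ) (d : ℝ) :
    gapFlux n 0 d = 1 / 2 * ((1 - d ^ 2) ^ n - (1 - d) ^ n) := by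
  induction n with
  | zero => simp [gapFlux]
  | succ n ih =>
    rw [gapFlux, ih, show upperProd 0 d = 1 - d by simp [upperProd],
      show lowerProd 0 d = 0 by simp [lowerProd], sqChooseSum_zero_left]
    ring

/-- The density of the gap `d`. -/
lemma integral_sqChooseSum (n : ℕ) (d : ℝ) :
    ∫ s in (0 : ℝ)..1, (1 - d) * sqChooseSum n (lowerProd s d) (upperProd s d) =
      ∫ r in d..1, (1 - r ^ 2) ^ n := by
  set D : ℝ → ℝ → ℝ := fun s r => -sqChooseSum n (lowerProd s r) (upperProd s r) + (1 - r) *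
    (sqChooseSumFst n (lowerProd s r) (upperProd s r) *
        (-s * ((1 - r) * s + r) + (1 - r) * s * (1 - s)) +
      sqChooseSumSnd n (lowerProd s r) (upperProd s r) *
        (-(1 - s) * (1 - (1 - r) * s) + (1 - r) * (1 - s) * s)) with hD
  have hcont : Continuous (Function.uncurry D) := by
    simp only [hD, Function.uncurry_def]
    fun_prop
  have hr : ∀ s, ∫ r in d..1, D s r =
      -((1 - d) * sqChooseSum n (lowerProd s d) (upperProd s d)) := by
    intro s
    rw [intervalIntegral.integral_eq_sub_of_hasDerivAt
      (f := fun r => (1 - r) * sqChooseSum n (lowerProd s r) (upperProd s r))]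
    · simp
    · intro r _
      have h := ((hasDerivAt_id r).const_sub 1).mul (hasDerivAt_sqChooseSum n
        (hasDerivAt_lowerProd_right s r) (hasDerivAt_upperProd_right s r))
      refine h.congr_deriv ?_
      simp only [hD, id]
      ring
    · exact (hcont.comp (Continuous.prodMk_right s)).intervalIntegrable _ _
  have hs : ∀ r, ∫ s in (0 : ℝ)..1, D s r = -(1 - r ^ 2) ^ n := by
    intro r
    rw [intervalIntegral.integral_eq_sub_of_hasDerivAt (f := fun s => gapFlux n s r -
      (s - 1 / 2) * sqChooseSum n (lowerProd s r) (upperProd s r))]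
    · rw [gapFlux_one, gapFlux_zero, show upperProd 0 r = 1 - r by simp [upperProd],
        show lowerProd 0 r = 0 by simp [lowerProd], show upperProd 1 r = 0 by simp [upperProd],
        show lowerProd 1 r = 1 - r by simp [lowerProd], sqChooseSum_zero_left,
        sqChooseSum_zero_right]
      ring
    · intro s _
      have h := (hasDerivAt_gapFlux n s r).sub (((hasDerivAt_id s).sub_const (1 / 2)).mul
        (hasDerivAt_sqChooseSum n (hasDerivAt_lowerProd_left s r) (hasDerivAt_upperProd_left s r)))
      refine h.congr_deriv ?_
      simp only [hD, id]
      ring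
    · exact (hcont.comp (Continuous.prodMk_left r)).intervalIntegrable _ _
  have hswap : ∫ s in (0 : ℝ)..1, ∫ r in d..1, D s r = ∫ r in d..1, ∫ s in (0 : ℝ)..1, D s r := by
    refine intervalIntegral_intervalIntegral_swap ?_
    exact (hcont.continuousOn.integrableOn_compact
      (isCompact_uIcc.prod isCompact_uIcc)).mono_set
      (prod_mono uIoc_subset_uIcc uIoc_subset_uIcc)
  simp_rw [hr, hs, intervalIntegral.integral_neg] at hswap
  exact neg_injective hswap

lemma sum_orderDensity_mul (n : ℕ) (x y : ℝ) :
    ∑ k : Fin (n + 1), orderDensity (n + 1) k x * orderDensity (n + 1) k y =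
      (n + 1) ^ 2 * sqChooseSum n (x * y) ((1 - x) * (1 - y)) := by
  rw [Fin.sum_univ_eq_sum_range
    (fun k => orderDensity (n + 1) k x * orderDensity (n + 1) k y) (n + 1), sqChooseSum,
    Finset.mul_sum]
  refine Finset.sum_congr rfl fun k _ => ?_
  rw [orderDensity_eq, orderDensity_eq, Nat.add_sub_cancel, mul_pow, mul_pow]
  push_cast
  ring

lemma integrable_prod_unif {f : ℝ × ℝ → ℝ} (hf : Continuous f) :
    Integrable f (unif.prod unif) := by
  rw [unif, Measure.prod_restrict]
  exact hf.continuousOn.integrableOn_compact (isCompact_Icc.prod isCompact_Icc)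

/-- The expected cost in terms of the joint densities of the order statistics. -/
lemma integral_sum_sortedTuple (n : ℕ) {f : ℝ × ℝ → ℝ} (hf : Continuous f) :
    ∫ ω : (Fin (n + 1) → ℝ) × (Fin (n + 1) → ℝ), ∑ i, f (sortedTuple ω.1 i, sortedTuple ω.2 i)
        ∂((unifPi (n + 1)).prod (unifPi (n + 1))) =
      (n + 1) ^ 2 * ∫ x in (0 : ℝ)..1, ∫ y in (0 : ℝ)..1,
        sqChooseSum n (x * y) ((1 - x) * (1 - y)) * f (x, y) := by
  have hc : ∀ k : Fin (n + 1), Continuous fun z : ℝ × ℝ =>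
      orderDensity (n + 1) k z.1 * orderDensity (n + 1) k z.2 * f z := fun k =>
    (((continuous_orderDensity _ k).comp continuous_fst).mul
      ((continuous_orderDensity _ k).comp continuous_snd)).mul hf
  rw [integral_finsetSum _ fun k _ => integrable_sortedTuple k hf]
  simp_rw [integral_sortedTuple _ hf.measurable]
  rw [← integral_finsetSum _ fun k _ => integrable_prod_unif (hc k)]
  simp_rw [← Finset.sum_mul, sum_orderDensity_mul, mul_assoc]
  rw [integral_const_mul, integral_prod _ (integrable_prod_unif (by fun_prop)), unif]
  simp_rw [integral_Icc_eq_integral_Ioc, ← intervalIntegral.integral_of_le zero_le_one]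

lemma integral_triangle_swap {F : ℝ → ℝ → ℝ} (hF : Continuous (Function.uncurry F)) :
    ∫ x in (0 : ℝ)..1, ∫ y in (0 : ℝ)..(1 - x), F x y =
      ∫ y in (0 : ℝ)..1, ∫ x in (0 : ℝ)..(1 - y), F x y := by
  set T : Set (ℝ × ℝ) := {z | z.1 + z.2 ≤ 1} with hT
  have hTm : MeasurableSet T := measurableSet_le (by fun_prop) measurable_const
  set G : ℝ → ℝ → ℝ := fun x y => T.indicator (Function.uncurry F) (x, y) with hG
  have h1 : ∀ x ∈ Icc (0 : ℝ) 1, ∫ y in (0 : ℝ)..1, G x y = ∫ y in (0 : ℝ)..(1 - x), F x y := by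
    intro x hx
    rw [← intervalIntegral.integral_indicator (a₃ := 1) (f := F x)
      (show 1 - x ∈ Icc (0 : ℝ) 1 from ⟨by linarith [hx.2], by linarith [hx.1]⟩)]
    congr 1
    ext y
    have : (x, y) ∈ T ↔ y ∈ {y | y ≤ 1 - x} := by
      simp only [hT, mem_ofPred_eq, le_sub_iff_add_le']
    by_cases h : (x, y) ∈ T
    · rw [hG, indicator_of_mem (this.1 h)]
      simp [h]
    · rw [hG, indicator_of_notMem (fun h' => h (this.2 h'))]
      simp [h]
  have h2 : ∀ y ∈ Icc (0 : ℝ) 1, ∫ x in (0 : ℝ)..1, G x y = ∫ x in (0 : ℝ)..(1 - y), F x y := by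
    intro y hy
    rw [← intervalIntegral.integral_indicator (a₃ := 1) (f := fun x => F x y)
      (show 1 - y ∈ Icc (0 : ℝ) 1 from ⟨by linarith [hy.2], by linarith [hy.1]⟩)]
    congr 1
    ext x
    have : (x, y) ∈ T ↔ x ∈ {x | x ≤ 1 - y} := by
      simp only [hT, mem_ofPred_eq, le_sub_iff_add_le]
    by_cases h : (x, y) ∈ T
    · rw [hG, indicator_of_mem (this.1 h)]
      simp [h]
    · rw [hG, indicator_of_notMem (fun h' => h (this.2 h'))]
      simp [h]
  have hswap : ∫ x in (0 : ℝ)..1, ∫ y in (0 : ℝ)..1, G x y =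
      ∫ y in (0 : ℝ)..1, ∫ x in (0 : ℝ)..1, G x y := by
    refine intervalIntegral_intervalIntegral_swap ?_
    have : IntegrableOn (Function.uncurry F) (uIoc (0 : ℝ) 1 ×ˢ uIoc (0 : ℝ) 1) :=
      (hF.continuousOn.integrableOn_compact (isCompact_uIcc.prod isCompact_uIcc)).mono_set
        (prod_mono uIoc_subset_uIcc uIoc_subset_uIcc)
    exact Integrable.indicator this hTm
  rw [intervalIntegral.integral_congr (g := fun x => ∫ y in (0 : ℝ)..1, G x y)
    (fun x hx => (h1 x (by rwa [uIcc_of_le zero_le_one] at hx)).symm), hswap]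
  exact intervalIntegral.integral_congr fun y hy => h2 y (by rwa [uIcc_of_le zero_le_one] at hy)

lemma integral_square_eq_two_mul {g : ℝ → ℝ → ℝ} (hg : Continuous (Function.uncurry g))
    (hrefl : ∀ x y, g (1 - x) (1 - y) = g x y) :
    ∫ x in (0 : ℝ)..1, ∫ y in (0 : ℝ)..1, g x y =
      2 * ∫ d in (0 : ℝ)..1, ∫ s in (0 : ℝ)..1, (1 - d) * g ((1 - d) * s) ((1 - d) * s + d) := by
  have hi : ∀ x a b, IntervalIntegrable (g x) volume a b := fun x a b =>
    (hg.comp (Continuous.prodMk_right x)).intervalIntegrable _ _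
  have hc1 : Continuous fun x => ∫ y in (0 : ℝ)..x, g x y :=
    intervalIntegral.continuous_parametric_intervalIntegral_of_continuous hg continuous_id
  have hsplit : ∀ x, ∫ y in (0 : ℝ)..1, g x y =
      (∫ y in (0 : ℝ)..x, g x y) + ∫ y in (0 : ℝ)..(1 - x), g x (x + y) := by
    intro x
    rw [← intervalIntegral.integral_add_adjacent_intervals (hi x 0 x) (hi x x 1),
      intervalIntegral.integral_comp_add_left (g x) x]
    simp
  have hc2 : Continuous fun x => ∫ y in (0 : ℝ)..(1 - x), g x (x + y) :=
    intervalIntegral.continuous_parametric_intervalIntegral_of_continuous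
      (f := fun x y => g x (x + y))
      (hg.comp (continuous_fst.prodMk (continuous_fst.add continuous_snd)))
      (continuous_const.sub continuous_id)
  have hA : ∫ x in (0 : ℝ)..1, ∫ y in (0 : ℝ)..x, g x y =
      ∫ x in (0 : ℝ)..1, ∫ y in (0 : ℝ)..(1 - x), g x (x + y) := by
    have h := intervalIntegral.integral_comp_sub_left (a := 0) (b := 1)
      (fun x => ∫ y in (0 : ℝ)..x, g x y) 1
    rw [sub_self, sub_zero] at h
    rw [← h]
    refine intervalIntegral.integral_congr fun x _ => ?_
    have h' := intervalIntegral.integral_comp_sub_left (a := 0) (b := 1 - x)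
      (fun y => g (1 - x) y) (1 - x)
    rw [sub_self, sub_zero] at h'
    simp only [← h']
    refine intervalIntegral.integral_congr fun y _ => ?_
    rw [← hrefl x (x + y), sub_sub]
  simp_rw [hsplit]
  rw [intervalIntegral.integral_add (hc1.intervalIntegrable _ _) (hc2.intervalIntegrable _ _), hA,
    ← two_mul, integral_triangle_swap (F := fun x y => g x (x + y))
      (hg.comp (continuous_fst.prodMk (continuous_fst.add continuous_snd)))]
  congr 1
  refine intervalIntegral.integral_congr fun d _ => ?_
  have h := intervalIntegral.smul_integral_comp_mul_left (a := 0) (b := 1)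
    (fun x => g x (x + d)) (1 - d)
  simp only [mul_zero, mul_one] at h
  rw [← h, smul_eq_mul, intervalIntegral.integral_const_mul]

lemma two_mul_integral_rpow_mul_integral {p : ℝ} (hp : 0 < p) (n : ℕ) :
    2 * ∫ d in (0 : ℝ)..1, d ^ p * ∫ r in d..1, (1 - r ^ 2) ^ n =
      (∫ t in (0 : ℝ)..1, t ^ (p / 2) * (1 - t) ^ n) / (p + 1) := by
  have hparts := intervalIntegral.integral_mul_deriv_eq_deriv_mul (a := 0) (b := 1)
    (u := fun d => ∫ r in d..1, (1 - r ^ 2) ^ n) (u' := fun d => -(1 - d ^ 2) ^ n)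
    (v := fun d : ℝ => d ^ (p + 1) / (p + 1)) (v' := fun d => d ^ p)
    (fun d _ => intervalIntegral.integral_hasDerivAt_left
      (Continuous.intervalIntegrable (by fun_prop) _ _)
      (Continuous.stronglyMeasurableAtFilter (by fun_prop) _ _)
      (Continuous.continuousAt (by fun_prop)))
    (fun d _ => by
      have h := (Real.hasDerivAt_rpow_const (x := d) (p := p + 1) (Or.inr (by linarith))).div_const
        (p + 1)
      refine h.congr_deriv ?_
      rw [add_sub_cancel_right]
      field_simp)
    (Continuous.intervalIntegrable (by fun_prop) _ _)
    (Continuous.intervalIntegrable (Real.continuous_rpow_const hp.le) _ _)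
  have hsubst := intervalIntegral.integral_comp_mul_deriv (a := 0) (b := 1)
    (f := fun d : ℝ => d ^ 2) (f' := fun d => 2 * d) (g := fun t => t ^ (p / 2) * (1 - t) ^ n)
    (fun d _ => by simpa using hasDerivAt_pow 2 d) (by fun_prop)
    ((Real.continuous_rpow_const (by positivity)).mul (by fun_prop))
  simp only [one_pow, ne_eq, OfNat.ofNat_ne_zero, not_false_eq_true, zero_pow] at hsubst
  rw [← hsubst]
  simp_rw [mul_comm (_ ^ p) (∫ r in _.._, _)]
  rw [hparts]
  have h0 : (0 : ℝ) ^ (p + 1) = 0 := Real.zero_rpow (by positivity)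
  simp only [intervalIntegral.integral_same, zero_mul, h0, zero_div, mul_zero, sub_zero, zero_sub]
  rw [← intervalIntegral.integral_neg, ← intervalIntegral.integral_const_mul,
    ← intervalIntegral.integral_div]
  refine intervalIntegral.integral_congr fun d hd => ?_
  rw [uIcc_of_le zero_le_one] at hd
  simp only [Function.comp]
  rw [← Real.rpow_natCast d 2, ← Real.rpow_mul hd.1, Real.rpow_add_one' hd.1 (by positivity)]
  push_cast
  rw [show 2 * (p / 2) = p by ring]
  ring

lemma integral_cost {p : ℝ} (hp : 1 < p) (n : ℕ) :
    ∫ ω : (Fin (n + 1) → ℝ) × (Fin (n + 1) → ℝ),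
        ∑ i, |sortedTuple ω.1 i - sortedTuple ω.2 i| ^ p
        ∂((unifPi (n + 1)).prod (unifPi (n + 1))) =
      (n + 1) ^ 2 * ((∫ t in (0 : ℝ)..1, t ^ (p / 2) * (1 - t) ^ n) / (p + 1)) := by
  have hp0 : 0 < p := by linarith
  have hpc : Continuous fun x : ℝ => x ^ p := Real.continuous_rpow_const hp0.le
  have hf : Continuous fun z : ℝ × ℝ => |z.1 - z.2| ^ p := hpc.comp (by fun_prop)
  rw [integral_sum_sortedTuple n hf, ← two_mul_integral_rpow_mul_integral hp0,
    integral_square_eq_two_mul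
      (g := fun x y => sqChooseSum n (x * y) ((1 - x) * (1 - y)) * |x - y| ^ p)
      (by simp only [Function.uncurry_def]; fun_prop)]
  · congr 2
    refine intervalIntegral.integral_congr fun d hd => ?_
    rw [uIcc_of_le zero_le_one] at hd
    rw [← integral_sqChooseSum, ← intervalIntegral.integral_const_mul]
    refine intervalIntegral.integral_congr fun s _ => ?_
    rw [show (1 - d) * s - ((1 - d) * s + d) = -d by ring, abs_neg, abs_of_nonneg hd.1,
      lowerProd, upperProd,
      show (1 - (1 - d) * s) * (1 - ((1 - d) * s + d)) =
        (1 - d) * (1 - s) * (1 - (1 - d) * s) by ring]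
    ring
  · intro x y
    rw [show (1 - x) - (1 - y) = -(x - y) by ring, abs_neg, sub_sub_cancel, sub_sub_cancel,
      sqChooseSum_comm]

lemma rpow_mul_integral_eq_GammaSeq {q : ℝ} (hq : 0 < q) (n : ℕ) :
    (n : ℝ) ^ (q + 1) * ∫ t in (0 : ℝ)..1, t ^ q * (1 - t) ^ n = Real.GammaSeq (q + 1) n := by
  have h := Complex.GammaSeq_eq_betaIntegral_of_re_pos (s := ((q + 1 : ℝ) : ℂ))
    (by simp; linarith) n
  have hb : Complex.betaIntegral ((q + 1 : ℝ) : ℂ) (n + 1) =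
      ((∫ t in (0 : ℝ)..1, t ^ q * (1 - t) ^ n : ℝ) : ℂ) := by
    rw [Complex.betaIntegral, ← intervalIntegral.integral_ofReal]
    refine intervalIntegral.integral_congr fun t ht => ?_
    rw [uIcc_of_le zero_le_one] at ht
    simp [Complex.ofReal_cpow ht.1]
  have hG : Complex.GammaSeq ((q + 1 : ℝ) : ℂ) n = (Real.GammaSeq (q + 1) n : ℂ) := by
    dsimp only [Real.GammaSeq, Complex.GammaSeq]
    push_cast
    rw [Complex.ofReal_cpow n.cast_nonneg]
    push_cast
    rfl
  rw [hG, hb, ← Complex.ofReal_natCast, ← Complex.ofReal_cpow n.cast_nonneg,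
    ← Complex.ofReal_mul] at h
  exact (Complex.ofReal_injective h).symm

end

/-- For `p > 1`, the rescaled average optimal cost per edge of the random
Euclidean assignment problem on `[0,1]` with cost `z^p` converges to
`Γ(1 + p/2)/(p+1)`. -/
theorem assignment_average_cost_asymptotics (p : ℝ) (hp : 1 < p) :
    Filter.Tendsto
      (fun N : ℕ =>
        (N : ℝ) ^ (p / 2) *
          ∫ ω : (Fin N → ℝ) × (Fin N → ℝ),
            ((1 : ℝ) / N) * ∑ i, |sortedTuple ω.1 i - sortedTuple ω.2 i| ^ p
          ∂((unifPi N).prod (unifPi N)))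
      Filter.atTop (nhds (Real.Gamma (1 + p / 2) / (p + 1))) := by
  rw [← Filter.tendsto_add_atTop_iff_nat 1]
  have h1 : Filter.Tendsto (fun n : ℕ => (1 + 1 / (n : ℝ)) ^ (p / 2 + 1)) Filter.atTop
      (nhds 1) := by
    have h := (tendsto_one_div_atTop_nhds_zero_nat (𝕜 := ℝ)).const_add 1
    rw [add_zero] at h
    simpa using h.rpow_const (p := p / 2 + 1) (Or.inl one_ne_zero)
  have h2 := (h1.mul (Real.GammaSeq_tendsto_Gamma (p / 2 + 1))).div_const (p + 1)
  rw [one_mul, add_comm (p / 2)] at h2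
  refine h2.congr' ?_
  filter_upwards [Filter.eventually_gt_atTop 0] with n hn
  have hn' : (0 : ℝ) < n := Nat.cast_pos.2 hn
  rw [integral_const_mul, integral_cost hp, add_comm 1 (p / 2),
    ← rpow_mul_integral_eq_GammaSeq (by linarith), ← mul_assoc,
    ← Real.mul_rpow (by positivity) hn'.le, show (1 + 1 / (n : ℝ)) * n = n + 1 by field_simp,
    Real.rpow_add_one (by positivity)]
  push_cast
  field_simp
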